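/- Let N ≥ 1, Q = 2N + 2, and suppose p > Q/(Q − 2). Then there exists a positive twice continuously differentiable function v : ℝ^N × ℝ^N × ℝ → ℝ such that −Δ_ℍ v(η) − v(η)^p > 0 for all η ∈ ℝ^N × ℝ^N × ℝ; in particular, v is a positive stationary supersolution of u_t − Δ_ℍ u = |u|^p + f whenever 0 < f ≤ −Δ_ℍ v − v^p. -/

import Mathlib

open MeasureTheory Real Set

noncomputable section

/-- Points of the Heisenberg group `ℍ^N`, written `η = (x, y, τ)`. -/
abbrev Heis (N : ℕ) : Type := (Fin N → ℝ) × (Fin N → ℝ) × ℝ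

/-- Partial derivative `∂u/∂x_i`. -/
def pdx {N : ℕ} (i : Fin N) (u : Heis N → ℝ) (η : Heis N) : ℝ :=
  deriv (fun s => u (Function.update η.1 i s, η.2.1, η.2.2)) (η.1 i)

/-- Partial derivative `∂u/∂y_i`. -/
def pdy {N : ℕ} (i : Fin N) (u : Heis N → ℝ) (η : Heis N) : ℝ :=
  deriv (fun s => u (η.1, Function.update η.2.1 i s, η.2.2)) (η.2.1 i)

/-- Partial derivative `∂u/∂τ`. -/
def pdt {N : ℕ} (u : Heis N → ℝ) (η : Heis N) : ℝ :=
  deriv (fun s => u (η.1, η.2.1, s)) η.2.2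

/-- The sub-Laplacian on the Heisenberg group, in its explicit second-order form
`Δ_ℍ u = Σ_i (∂²u/∂x_i² + ∂²u/∂y_i² + 4 y_i ∂²u/(∂x_i ∂τ) − 4 x_i ∂²u/(∂y_i ∂τ)
  + 4 (x_i² + y_i²) ∂²u/∂τ²)`. -/
def subLaplacian {N : ℕ} (u : Heis N → ℝ) (η : Heis N) : ℝ :=
  ∑ i : Fin N,
    (pdx i (pdx i u) η + pdy i (pdy i u) η
      + 4 * η.2.1 i * pdx i (pdt u) η
      - 4 * η.1 i * pdy i (pdt u) η
      + 4 * ((η.1 i) ^ 2 + (η.2.1 i) ^ 2) * pdt (pdt u) η)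

/-- `|η|_ℍ⁴ = (|x|² + |y|²)² + τ²`. -/
def heisNorm4 {N : ℕ} (η : Heis N) : ℝ :=
  ((∑ i : Fin N, (η.1 i) ^ 2) + (∑ i : Fin N, (η.2.1 i) ^ 2)) ^ 2 + η.2.2 ^ 2

/-- The homogeneous norm `|η|_ℍ = ((|x|² + |y|²)² + τ²)^{1/4}`. -/
def heisNorm {N : ℕ} (η : Heis N) : ℝ := heisNorm4 η ^ ((4 : ℝ)⁻¹)

/-- The square of the Euclidean norm of the horizontal part `(x, y)` of a point of `ℍ^N`. -/
def horizSq {N : ℕ} (η : Heis N) : ℝ := (∑ i, (η.1 i) ^ 2) + ∑ i, (η.2.1 i) ^ 2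

lemma horizSq_nonneg {N : ℕ} (η : Heis N) : 0 ≤ horizSq η :=
  add_nonneg (Finset.sum_nonneg fun _ _ => sq_nonneg _) (Finset.sum_nonneg fun _ _ => sq_nonneg _)

lemma hasDerivAt_sum_sq_update {N : ℕ} (x : Fin N → ℝ) (i : Fin N) (s : ℝ) :
    HasDerivAt (fun s => ∑ j, (Function.update x i s j) ^ 2) (2 * s) s := by
  have h : (fun s : ℝ => ∑ j, (Function.update x i s j) ^ 2)
      = fun s => s ^ 2 + ∑ j ∈ Finset.univ.erase i, x j ^ 2 := by
    funext s
    rw [← Finset.add_sum_erase _ _ (Finset.mem_univ i), Function.update_self]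
    congr 1
    refine Finset.sum_congr rfl fun j hj => ?_
    rw [Function.update_of_ne (Finset.ne_of_mem_erase hj)]
  rw [h]
  simpa using (hasDerivAt_pow 2 s).add_const (∑ j ∈ Finset.univ.erase i, x j ^ 2)

section Cylindrical

variable {N : ℕ} {F D : ℝ → ℝ → ℝ}

lemma hasDerivAt_cylindrical_x (hF : ∀ r t, -1 < r → HasDerivAt (fun r => F r t) (D r t) r)
    (i : Fin N) (η : Heis N) :
    HasDerivAt (fun s => F (horizSq (Function.update η.1 i s, η.2.1, η.2.2)) η.2.2)
      (D (horizSq η) η.2.2 * (2 * η.1 i)) (η.1 i) := by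
  have hρ : HasDerivAt (fun s => horizSq (Function.update η.1 i s, η.2.1, η.2.2))
      (2 * η.1 i) (η.1 i) := by
    simpa only [horizSq] using
      (hasDerivAt_sum_sq_update η.1 i (η.1 i)).add_const (∑ j, η.2.1 j ^ 2)
  have hr : -1 < horizSq η := by linarith [horizSq_nonneg η]
  refine HasDerivAt.comp (η.1 i) (h₂ := fun r => F r η.2.2) ?_ hρ
  simpa using hF _ _ hr

lemma hasDerivAt_cylindrical_y (hF : ∀ r t, -1 < r → HasDerivAt (fun r => F r t) (D r t) r)
    (i : Fin N) (η : Heis N) :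
    HasDerivAt (fun s => F (horizSq (η.1, Function.update η.2.1 i s, η.2.2)) η.2.2)
      (D (horizSq η) η.2.2 * (2 * η.2.1 i)) (η.2.1 i) := by
  have hρ : HasDerivAt (fun s => horizSq (η.1, Function.update η.2.1 i s, η.2.2))
      (2 * η.2.1 i) (η.2.1 i) := by
    simpa only [horizSq] using
      (hasDerivAt_sum_sq_update η.2.1 i (η.2.1 i)).const_add (∑ j, η.1 j ^ 2)
  have hr : -1 < horizSq η := by linarith [horizSq_nonneg η]
  refine HasDerivAt.comp (η.2.1 i) (h₂ := fun r => F r η.2.2) ?_ hρ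
  simpa using hF _ _ hr

/-- On functions of `r = |x|² + |y|²` and `τ` the sub-Laplacian acts as
`4 (r (∂_r² + ∂_τ²) + N ∂_r)`. -/
lemma subLaplacian_cylindrical {F₁ F₂ F₁₁ F₁₂ F₂₂ : ℝ → ℝ → ℝ}
    (h₁ : ∀ r t, -1 < r → HasDerivAt (fun r => F r t) (F₁ r t) r)
    (h₂ : ∀ r t, -1 < r → HasDerivAt (fun t => F r t) (F₂ r t) t)
    (h₁₁ : ∀ r t, -1 < r → HasDerivAt (fun r => F₁ r t) (F₁₁ r t) r)
    (h₁₂ : ∀ r t, -1 < r → HasDerivAt (fun r => F₂ r t) (F₁₂ r t) r)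
    (h₂₂ : ∀ r t, -1 < r → HasDerivAt (fun t => F₂ r t) (F₂₂ r t) t) (η : Heis N) :
    subLaplacian (fun η : Heis N => F (horizSq η) η.2.2) η
      = 4 * (horizSq η * (F₁₁ (horizSq η) η.2.2 + F₂₂ (horizSq η) η.2.2)
          + N * F₁ (horizSq η) η.2.2) := by
  have hr : ∀ η : Heis N, -1 < horizSq η := fun η => by linarith [horizSq_nonneg η]
  have hx : ∀ i, pdx i (fun η : Heis N => F (horizSq η) η.2.2)
      = fun η => F₁ (horizSq η) η.2.2 * (2 * η.1 i) :=
    fun i => funext fun η => (hasDerivAt_cylindrical_x h₁ i η).deriv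
  have hy : ∀ i, pdy i (fun η : Heis N => F (horizSq η) η.2.2)
      = fun η => F₁ (horizSq η) η.2.2 * (2 * η.2.1 i) :=
    fun i => funext fun η => (hasDerivAt_cylindrical_y h₁ i η).deriv
  have ht : pdt (fun η : Heis N => F (horizSq η) η.2.2) = fun η => F₂ (horizSq η) η.2.2 :=
    funext fun η => (h₂ _ _ (hr η)).deriv
  have hxx : ∀ i, pdx i (fun η : Heis N => F₁ (horizSq η) η.2.2 * (2 * η.1 i)) η
      = F₁₁ (horizSq η) η.2.2 * (2 * η.1 i) * (2 * η.1 i) + F₁ (horizSq η) η.2.2 * 2 := by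
    intro i
    have := (hasDerivAt_cylindrical_x h₁₁ i η).mul ((hasDerivAt_id (η.1 i)).const_mul 2)
    simpa [pdx, Pi.mul_def] using this.deriv
  have hyy : ∀ i, pdy i (fun η : Heis N => F₁ (horizSq η) η.2.2 * (2 * η.2.1 i)) η
      = F₁₁ (horizSq η) η.2.2 * (2 * η.2.1 i) * (2 * η.2.1 i) + F₁ (horizSq η) η.2.2 * 2 := by
    intro i
    have := (hasDerivAt_cylindrical_y h₁₁ i η).mul ((hasDerivAt_id (η.2.1 i)).const_mul 2)
    simpa [pdy, Pi.mul_def] using this.deriv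
  have htx : ∀ i, pdx i (fun η : Heis N => F₂ (horizSq η) η.2.2) η
      = F₁₂ (horizSq η) η.2.2 * (2 * η.1 i) :=
    fun i => (hasDerivAt_cylindrical_x h₁₂ i η).deriv
  have hty : ∀ i, pdy i (fun η : Heis N => F₂ (horizSq η) η.2.2) η
      = F₁₂ (horizSq η) η.2.2 * (2 * η.2.1 i) :=
    fun i => (hasDerivAt_cylindrical_y h₁₂ i η).deriv
  have htt : pdt (fun η : Heis N => F₂ (horizSq η) η.2.2) η = F₂₂ (horizSq η) η.2.2 :=
    (h₂₂ _ _ (hr η)).deriv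
  simp only [subLaplacian, hx, hy, ht, hxx, hyy, htx, hty, htt]
  set A := F₁₁ (horizSq η) η.2.2
  set B := F₂₂ (horizSq η) η.2.2
  set C := F₁ (horizSq η) η.2.2
  set E := F₁₂ (horizSq η) η.2.2
  calc _ = ∑ i : Fin N, ((4 * (A + B)) * (η.1 i) ^ 2 + (4 * (A + B)) * (η.2.1 i) ^ 2 + 4 * C) :=
        Finset.sum_congr rfl fun i _ => by ring
    _ = _ := by
        simp only [Finset.sum_add_distrib, ← Finset.mul_sum, Finset.sum_const, Finset.card_univ,
          Fintype.card_fin, nsmul_eq_mul, horizSq]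
        ring

end Cylindrical

/-- The square of the distance from `(r, t)` to `(-1, 0)`. -/
def shiftSq (r t : ℝ) : ℝ := (1 + r) ^ 2 + t ^ 2

lemma shiftSq_pos {r : ℝ} (t : ℝ) (hr : -1 < r) : 0 < shiftSq r t := by
  have : 0 < 1 + r := by linarith
  unfold shiftSq; positivity

lemma hasDerivAt_shiftSq_rpow_left {r : ℝ} (t : ℝ) (hr : -1 < r) {c d : ℝ} (h : d = c - 1) :
    HasDerivAt (fun r => shiftSq r t ^ c) (2 * c * (1 + r) * shiftSq r t ^ d) r := by
  subst h
  have hg : HasDerivAt (fun r => shiftSq r t) (2 * (1 + r)) r := by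
    simpa [shiftSq] using (((hasDerivAt_id r).const_add 1).pow 2).add_const (t ^ 2)
  convert hg.rpow_const (p := c) (Or.inl (shiftSq_pos t hr).ne') using 1
  ring

lemma hasDerivAt_shiftSq_rpow_right {r : ℝ} (t : ℝ) (hr : -1 < r) {c d : ℝ} (h : d = c - 1) :
    HasDerivAt (fun t => shiftSq r t ^ c) (2 * c * t * shiftSq r t ^ d) t := by
  subst h
  have hg : HasDerivAt (fun t => shiftSq r t) (2 * t) t := by
    simpa [shiftSq] using ((hasDerivAt_id t).pow 2).const_add ((1 + r) ^ 2)
  convert hg.rpow_const (p := c) (Or.inl (shiftSq_pos t hr).ne') using 1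
  ring

/-- The profile `G ^ (-a) - κ (1 + r) G ^ (-e)` with `G = (1 + r)² + t²`. -/
def profile (κ a e r t : ℝ) : ℝ :=
  shiftSq r t ^ (-a) - κ * ((1 + r) * shiftSq r t ^ (-e))

lemma subLaplacian_profile {N : ℕ} (ε κ a e : ℝ) (η : Heis N) :
    subLaplacian (fun η : Heis N => ε * profile κ a e (horizSq η) η.2.2) η
      = 4 * ε * (horizSq η * (4 * a ^ 2 * shiftSq (horizSq η) η.2.2 ^ (-a - 1)
            + 4 * e * (1 - e) * κ * (1 + horizSq η) * shiftSq (horizSq η) η.2.2 ^ (-e - 1))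
          - N * (2 * a * (1 + horizSq η) * shiftSq (horizSq η) η.2.2 ^ (-a - 1)
            + κ * shiftSq (horizSq η) η.2.2 ^ (-e)
            - 2 * e * κ * (1 + horizSq η) ^ 2 * shiftSq (horizSq η) η.2.2 ^ (-e - 1))) := by
  have hid : ∀ r : ℝ, HasDerivAt (fun r : ℝ => 1 + r) 1 r :=
    fun r => (hasDerivAt_id r).const_add 1
  rw [subLaplacian_cylindrical (N := N) (F := fun r t => ε * profile κ a e r t)
    (F₁ := fun r t => ε * (2 * (-a) * (1 + r) * shiftSq r t ^ (-a - 1)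
      - κ * (1 * shiftSq r t ^ (-e) + (1 + r) * (2 * (-e) * (1 + r) * shiftSq r t ^ (-e - 1)))))
    (F₂ := fun r t => ε * (2 * (-a) * t * shiftSq r t ^ (-a - 1)
      - κ * ((1 + r) * (2 * (-e) * t * shiftSq r t ^ (-e - 1)))))
    (F₁₁ := fun r t => ε * ((2 * (-a) * 1) * shiftSq r t ^ (-a - 1)
      + 2 * (-a) * (1 + r) * (2 * (-a - 1) * (1 + r) * shiftSq r t ^ (-a - 2))
      - κ * (1 * (2 * (-e) * (1 + r) * shiftSq r t ^ (-e - 1))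
        + (1 * (2 * (-e) * (1 + r) * shiftSq r t ^ (-e - 1))
          + (1 + r) * (2 * (-e) * 1 * shiftSq r t ^ (-e - 1)
            + 2 * (-e) * (1 + r) * (2 * (-e - 1) * (1 + r) * shiftSq r t ^ (-e - 2)))))))
    (F₁₂ := fun r t => ε * (2 * (-a) * t * (2 * (-a - 1) * (1 + r) * shiftSq r t ^ (-a - 2))
      - κ * (1 * (2 * (-e) * t * shiftSq r t ^ (-e - 1))
        + (1 + r) * (2 * (-e) * t * (2 * (-e - 1) * (1 + r) * shiftSq r t ^ (-e - 2))))))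
    (F₂₂ := fun r t => ε * ((2 * (-a) * 1) * shiftSq r t ^ (-a - 1)
      + 2 * (-a) * t * (2 * (-a - 1) * t * shiftSq r t ^ (-a - 2))
      - κ * ((1 + r) * (2 * (-e) * 1 * shiftSq r t ^ (-e - 1)
        + 2 * (-e) * t * (2 * (-e - 1) * t * shiftSq r t ^ (-e - 2))))))]
  · set r := horizSq η with hr
    set t := η.2.2
    have hG : 0 < shiftSq r t := shiftSq_pos t (by linarith [horizSq_nonneg η])
    have hstep : ∀ c : ℝ, shiftSq r t ^ (c - 1) = ((1 + r) ^ 2 + t ^ 2) * shiftSq r t ^ (c - 2) := by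
      intro c
      rw [show c - 1 = 1 + (c - 2) by ring, rpow_add hG, rpow_one, shiftSq]
    rw [hstep (-a), hstep (-e)]
    ring
  · intro r t hr
    exact ((hasDerivAt_shiftSq_rpow_left t hr rfl).sub
      (((hid r).mul (hasDerivAt_shiftSq_rpow_left t hr rfl)).const_mul κ)).const_mul ε
  · intro r t hr
    exact ((hasDerivAt_shiftSq_rpow_right t hr rfl).sub
      (((hasDerivAt_shiftSq_rpow_right t hr rfl).const_mul (1 + r)).const_mul κ)).const_mul ε
  · intro r t hr
    exact ((((hid r).const_mul _).mul (hasDerivAt_shiftSq_rpow_left t hr (by ring))).sub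
      (((hasDerivAt_shiftSq_rpow_left t hr rfl).const_mul 1 |>.congr_deriv (by ring) |>.add
        ((hid r).mul (((hid r).const_mul _).mul
          (hasDerivAt_shiftSq_rpow_left t hr (by ring))))).const_mul κ)).const_mul ε
  · intro r t hr
    exact (((hasDerivAt_shiftSq_rpow_left t hr (by ring)).const_mul _).sub
      (((hid r).mul ((hasDerivAt_shiftSq_rpow_left t hr (by ring)).const_mul _)).const_mul
        κ)).const_mul ε
  · intro r t hr
    exact ((((hasDerivAt_id t).const_mul _).mul (hasDerivAt_shiftSq_rpow_right t hr (by ring))).sub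
      (((((hasDerivAt_id t).const_mul _).mul
        (hasDerivAt_shiftSq_rpow_right t hr (by ring))).const_mul (1 + r)).const_mul κ)).const_mul ε

lemma contDiff_profile {N : ℕ} (ε κ a e : ℝ) :
    ContDiff ℝ 2 (fun η : Heis N => ε * profile κ a e (horizSq η) η.2.2) := by
  have hρ : ContDiff ℝ 2 (fun η : Heis N => horizSq η) := by
    unfold horizSq; fun_prop
  have hG : ContDiff ℝ 2 (fun η : Heis N => shiftSq (horizSq η) η.2.2) := by
    unfold shiftSq; fun_prop
  have hne : ∀ η : Heis N, shiftSq (horizSq η) η.2.2 ≠ 0 :=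
    fun η => (shiftSq_pos _ (by linarith [horizSq_nonneg η])).ne'
  have hpow : ∀ c : ℝ, ContDiff ℝ 2 (fun η : Heis N => shiftSq (horizSq η) η.2.2 ^ c) :=
    fun c => hG.rpow_const_of_ne hne
  exact contDiff_const.mul
    ((hpow _).sub (contDiff_const.mul ((contDiff_const.add hρ).mul (hpow _))))

/-- For `q = √G` the profile with exponents `β / 2` and `(β + 1) / 2` is comparable to `q ^ (-β)`. -/
lemma profile_bounds {κ β r t : ℝ} (hκ : 0 ≤ κ) (hκ₂ : κ < 1) (hr : 0 ≤ r) :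
    0 < profile κ (β / 2) ((β + 1) / 2) r t ∧
      profile κ (β / 2) ((β + 1) / 2) r t ≤ √(shiftSq r t) ^ (-β) := by
  have hG : 0 < shiftSq r t := shiftSq_pos t (by linarith)
  set q := √(shiftSq r t) with hq
  have hq0 : 0 < q := Real.sqrt_pos.2 hG
  have hrq : 1 + r ≤ q := Real.le_sqrt_of_sq_le (by unfold shiftSq; nlinarith [sq_nonneg t])
  have hpow : ∀ c : ℝ, shiftSq r t ^ (-(c / 2)) = q ^ (-c) := by
    intro c
    rw [hq, Real.sqrt_eq_rpow, ← rpow_mul hG.le]; congr 1; ring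
  have hq1 : q ^ (-β) = q * q ^ (-(β + 1)) := by
    rw [show -β = 1 + -(β + 1) by ring, rpow_add hq0, rpow_one]
  have hP : 0 < q ^ (-(β + 1)) := rpow_pos_of_pos hq0 _
  rw [profile, hpow, hpow, hq1]
  constructor
  · have : 0 < (q - κ * (1 + r)) := by nlinarith
    nlinarith [mul_pos this hP]
  · have : 0 ≤ κ * ((1 + r) * q ^ (-(β + 1))) := by positivity
    linarith

lemma neg_subLaplacian_profile_ge {N : ℕ} {ε κ β : ℝ} (hε : 0 ≤ ε) (hκ : 0 ≤ κ) (hβ : 0 ≤ β)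
    (hκβ : κ * (1 + (β + 1) * N) ≤ β * (N - β)) (η : Heis N) :
    4 * ε * (N * κ * √(shiftSq (horizSq η) η.2.2) ^ (-β - 1))
      ≤ -subLaplacian (fun η : Heis N => ε * profile κ (β / 2) ((β + 1) / 2) (horizSq η) η.2.2)
        η := by
  rw [subLaplacian_profile]
  have hr := horizSq_nonneg η
  set r := horizSq η
  set t := η.2.2
  have hG : 0 < shiftSq r t := shiftSq_pos t (by linarith)
  set q := √(shiftSq r t) with hq
  have hq0 : 0 < q := Real.sqrt_pos.2 hG
  have hrq : 1 + r ≤ q := Real.le_sqrt_of_sq_le (by unfold shiftSq; nlinarith [sq_nonneg t])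
  have hpow : ∀ c : ℝ, shiftSq r t ^ c = q ^ (2 * c) := by
    intro c
    rw [hq, Real.sqrt_eq_rpow, ← rpow_mul hG.le]; congr 1; ring
  set P := q ^ (-β - 3) with hP
  have hP0 : 0 < P := rpow_pos_of_pos hq0 _
  have e1 : shiftSq r t ^ (-(β / 2) - 1) = q * P := by
    rw [hpow, show 2 * (-(β / 2) - 1) = 1 + (-β - 3) by ring, rpow_add hq0, rpow_one]
  have e2 : shiftSq r t ^ (-((β + 1) / 2)) = q ^ 2 * P := by
    rw [hpow, show 2 * (-((β + 1) / 2)) = (2 : ℕ) + (-β - 3) by push_cast; ring, rpow_add hq0,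
      rpow_natCast]
  have e3 : shiftSq r t ^ (-((β + 1) / 2) - 1) = P := by
    rw [hpow, show 2 * (-((β + 1) / 2) - 1) = -β - 3 by ring]
  have e4 : q ^ (-β - 1) = q ^ 2 * P := by
    rw [show -β - 1 = (2 : ℕ) + (-β - 3) by push_cast; ring, rpow_add hq0, rpow_natCast]
  rw [e1, e2, e3, e4]
  have hN : (0 : ℝ) ≤ N := Nat.cast_nonneg N
  have key : 0 ≤ q * (β * (N * (1 + r) - β * r)) + (β ^ 2 - 1) * κ * r * (1 + r)
      - N * (β + 1) * κ * (1 + r) ^ 2 := by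
    have k1 : (κ * (1 + (β + 1) * N)) * (q * (1 + r)) ≤ (β * (N - β)) * (q * (1 + r)) :=
      mul_le_mul_of_nonneg_right hκβ (by positivity)
    have k2 : 0 ≤ q * β ^ 2 := by positivity
    have k3 : 0 ≤ κ * β ^ 2 * (r * (1 + r)) := by positivity
    have k4 : 0 ≤ κ * ((1 + r) * (q - r)) :=
      mul_nonneg hκ (mul_nonneg (by linarith) (by linarith))
    have k5 : 0 ≤ κ * (β + 1) * N * ((1 + r) * (q - (1 + r))) :=
      mul_nonneg (by positivity) (mul_nonneg (by linarith) (by linarith))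
    linarith
  have := mul_nonneg (mul_nonneg hε hP0.le) key
  linarith

/-- supercritical case: for `p > Q/(Q−2)` with `Q = 2N+2`, there is a
positive `C²` function `v` with `−Δ_ℍ v − v^p > 0` everywhere; in particular `v` is a
positive stationary supersolution of `u_t − Δ_ℍ u = |u|^p + f` whenever
`0 < f ≤ −Δ_ℍ v − v^p`. -/
theorem exists_stationary_supersolution {N : ℕ} (hN : 1 ≤ N) (p : ℝ)
    (hp : (2 * (N : ℝ) + 2) / ((2 * (N : ℝ) + 2) - 2) < p) :
    ∃ v : Heis N → ℝ, ContDiff ℝ 2 v ∧ (∀ η, 0 < v η) ∧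
      (∀ η, 0 < -subLaplacian v η - v η ^ p) ∧
      ∀ f : Heis N → ℝ, (∀ η, 0 < f η) →
        (∀ η, f η ≤ -subLaplacian v η - v η ^ p) →
        ∀ η, |v η| ^ p + f η ≤ -subLaplacian v η := by
  have hN' : (1 : ℝ) ≤ N := by exact_mod_cast hN
  have hpN : (1 : ℝ) < N * (p - 1) := by
    rw [div_lt_iff₀ (by linarith)] at hp
    linarith
  have hp1 : 0 < p - 1 := by
    by_contra h
    nlinarith
  set β : ℝ := 1 / (p - 1) with hβdef
  have hβ : 0 < β := by positivity
  have hβN : β < N := by rw [hβdef, div_lt_iff₀ hp1]; exact hpN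
  have hβp : β * p = β + 1 := by rw [hβdef]; field_simp; ring
  have hden : 0 < 1 + (β + 1) * N := by positivity
  obtain ⟨κ, hκ, hκβ, hκ1⟩ : ∃ κ : ℝ, 0 < κ ∧ κ * (1 + (β + 1) * N) ≤ β * (N - β) ∧ κ < 1 := by
    have hnum : 0 < β * (N - β) := mul_pos hβ (by linarith)
    refine ⟨β * (N - β) / (1 + (β + 1) * N), by positivity, (div_mul_cancel₀ _ hden.ne').le, ?_⟩
    rw [div_lt_one hden]
    nlinarith
  set ε : ℝ := κ ^ (1 / (p - 1)) with hεdef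
  have hε : 0 < ε := rpow_pos_of_pos hκ _
  have hεp : ε ^ p = κ * ε := by
    rw [hεdef, ← rpow_mul hκ.le, ← rpow_one_add' hκ.le (by positivity)]
    congr 1; field_simp; ring
  have hb := fun η : Heis N =>
    profile_bounds (β := β) (t := η.2.2) hκ.le hκ1 (horizSq_nonneg η)
  have hpos : ∀ η : Heis N, 0 < ε * profile κ (β / 2) ((β + 1) / 2) (horizSq η) η.2.2 :=
    fun η => mul_pos hε (hb η).1
  refine ⟨fun η => ε * profile κ (β / 2) ((β + 1) / 2) (horizSq η) η.2.2,
    contDiff_profile _ _ _ _, hpos, fun η => ?_, fun f _ hf η => ?_⟩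
  · have hlap := neg_subLaplacian_profile_ge hε.le hκ.le hβ.le hκβ η
    have hq0 : 0 < √(shiftSq (horizSq η) η.2.2) :=
      Real.sqrt_pos.2 (shiftSq_pos _ (by linarith [horizSq_nonneg η]))
    set q := √(shiftSq (horizSq η) η.2.2)
    have hv : (ε * profile κ (β / 2) ((β + 1) / 2) (horizSq η) η.2.2) ^ p
        ≤ κ * ε * q ^ (-β - 1) := by
      calc _ ≤ (ε * q ^ (-β)) ^ p :=
            rpow_le_rpow (hpos η).le (mul_le_mul_of_nonneg_left (hb η).2 hε.le) (by linarith)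
        _ = _ := by
            rw [mul_rpow hε.le (rpow_pos_of_pos hq0 _).le, hεp, ← rpow_mul hq0.le]
            congr 2; linarith
    have hpq : 0 < κ * ε * q ^ (-β - 1) := by positivity
    have : κ * ε * q ^ (-β - 1) * 1 ≤ κ * ε * q ^ (-β - 1) * N :=
      mul_le_mul_of_nonneg_left hN' hpq.le
    simp only
    linarith
  · have := hf η
    rw [abs_of_pos (hpos η)]
    linarith
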